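/- Let G be a finite non-cyclic group whose order is invertible in F, and let q be the smallest prime divisor of |G|. Then σ(G) ≤ |G|/q; that is, q · σ(G,V) ≤ |G| for every finite-dimensional G-module V. -/

import Mathlib

open scoped ENNReal


open MvPolynomial

/-- The (right) action of a group element `g` on the coordinate ring `F[V]` of `V = ι → F`,
determined by `(f^g)(v) = f (g • v)` where `g` acts on `V` through the representation `ρ`. -/
noncomputable def polyAct {F : Type*} [Field F] {G : Type*} [Group G] {ι : Type*}
    [Fintype ι] [DecidableEq ι] (ρ : Representation F G (ι → F)) (g : G) :
    MvPolynomial ι F →ₐ[F] MvPolynomial ι F :=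
  MvPolynomial.aeval (fun i => ∑ j, (ρ g (Pi.single j 1) i) • MvPolynomial.X j)

/-- The ring of polynomial invariants `F[V]^G`. -/
noncomputable def invRing {F : Type*} [Field F] {G : Type*} [Group G] {ι : Type*}
    [Fintype ι] [DecidableEq ι] (ρ : Representation F G (ι → F)) :
    Subalgebra F (MvPolynomial ι F) :=
  ⨅ g : G, AlgHom.equalizer (polyAct ρ g) (AlgHom.id F (MvPolynomial ι F))

/-- The degree `d` homogeneous component of a graded subalgebra `S` of the polynomial ring,
as a subspace of the polynomial ring. -/
noncomputable def subComp {F : Type*} [Field F] {ι : Type*} (S : Subalgebra F (MvPolynomial ι F)) (d : ℕ) :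
    Submodule F (MvPolynomial ι F) :=
  Subalgebra.toSubmodule S ⊓ homogeneousSubmodule ι F d

/-- `S_+`, the span of the homogeneous elements of positive degree of `S`. -/
noncomputable def subPos {F : Type*} [Field F] {ι : Type*} (S : Subalgebra F (MvPolynomial ι F)) :
    Submodule F (MvPolynomial ι F) :=
  ⨆ d ∈ Set.Ioi (0 : ℕ), subComp S d

/-- `β_k(S)`, the top degree of `S_+ / S_+^{k+1}`, i.e. the supremum (in `ℕ∞`) of the degrees `d`
such that the degree `d` component of `S_+` is not contained in `S_+^{k+1}`. -/
noncomputable def betaAlg {F : Type*} [Field F] {ι : Type*}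
    (S : Subalgebra F (MvPolynomial ι F)) (k : ℕ) : ℕ∞ :=
  sSup ((fun d : ℕ => (d : ℕ∞)) '' {d | 0 < d ∧ ¬ subComp S d ≤ subPos S ^ (k + 1)})

/-- `β_k(F[V], S)`, the top degree of `F[V]/S_+^k F[V]`, i.e. the supremum (in `ℕ∞`) of the
degrees `d` such that the degree `d` component of the polynomial ring is not contained in
`S_+^k ⬝ F[V]`. -/
noncomputable def betaMod {F : Type*} [Field F] {ι : Type*}
    (S : Subalgebra F (MvPolynomial ι F)) (k : ℕ) : ℕ∞ :=
  sSup ((fun d : ℕ => (d : ℕ∞)) ''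
    {d | ¬ homogeneousSubmodule ι F d ≤ subPos S ^ k * (⊤ : Submodule F (MvPolynomial ι F))})

/-- `β_k(G)`, the supremum over all finite dimensional `G`-modules `V` of `β_k(F[V]^G)`. -/
noncomputable def betaGrp (F : Type*) [Field F] (G : Type*) [Group G] (k : ℕ) : ℕ∞ :=
  ⨆ (n : ℕ) (ρ : Representation F G (Fin n → F)), betaAlg (invRing ρ) k

/-- `S` is a finitely generated module over its subalgebra `T`. -/
noncomputable def fgOver {F : Type*} [Field F] {ι : Type*} (S T : Subalgebra F (MvPolynomial ι F)) : Prop :=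
  ∃ B : Finset (MvPolynomial ι F), (B : Set (MvPolynomial ι F)) ⊆ S ∧
    Subalgebra.toSubmodule S ≤ Subalgebra.toSubmodule T * Submodule.span F (B : Set (MvPolynomial ι F))

/-- `σ(S)`: the minimal `d` such that `S` is a finitely generated module over the subalgebra
`F[S_{≤ d}]` generated by the homogeneous elements of `S` of degree at most `d`. -/
noncomputable def sigmaAlg {F : Type*} [Field F] {ι : Type*}
    (S : Subalgebra F (MvPolynomial ι F)) : ℕ :=
  sInf {d : ℕ | fgOver S (Algebra.adjoin F (⋃ i ∈ Set.Iic d, (subComp S i : Set (MvPolynomial ι F))))}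

/-- `σ(G)`, the supremum over all finite dimensional `G`-modules `V` of `σ(F[V]^G)`. -/
noncomputable def sigmaGrp (F : Type*) [Field F] (G : Type*) [Group G] : ℕ∞ :=
  ⨆ (n : ℕ) (ρ : Representation F G (Fin n → F)), (sigmaAlg (invRing ρ) : ℕ∞)

/-- An irreducible (simple, nonzero) representation. -/
def IsIrredRep {F : Type*} [Field F] {G : Type*} [Group G] {V : Type*}
    [AddCommGroup V] [Module F V] (π : Representation F G V) : Prop :=
  Nontrivial V ∧ ∀ W : Submodule F V, (∀ g : G, ∀ x ∈ W, π g x ∈ W) → W = ⊥ ∨ W = ⊤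

section FunctionSpace

/-- Pull back functions along a map. -/
def pbk (K : Type*) [Field K] {α β : Type*} (φ : α → β) : (β → K) →ₐ[K] (α → K) where
  toFun f := f ∘ φ
  map_one' := rfl
  map_mul' _ _ := rfl
  map_zero' := rfl
  map_add' _ _ := rfl
  commutes' _ := rfl

@[simp] lemma pbk_apply {K : Type*} [Field K] {α β : Type*} (φ : α → β) (f : β → K) (a : α) :
    pbk K φ f a = f (φ a) := rfl

lemma submodule_pow_mono {R A : Type*} [CommSemiring R] [CommSemiring A] [Algebra R A]
    {U V : Submodule R A} (h : U ≤ V) (i : ℕ) : U ^ i ≤ V ^ i := by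
  induction i with
  | zero => simp
  | succ i ih => rw [pow_succ, pow_succ]; exact Submodule.mul_le.2 fun a ha b hb => Submodule.mul_mem_mul (ih ha) (h hb)

/-- Stability under right translations. -/
def TStable {K : Type*} [Field K] {G : Type*} [Group G] (W : Submodule K (G → K)) : Prop :=
  ∀ h : G, ∀ f ∈ W, pbk K (fun x => x * h) f ∈ W

/-- Every nonzero translation stable space of functions has a power of small exponent containing
the constant function one. -/
def SigBound (K : Type*) [Field K] (G : Type*) [Group G] (d : ℕ) : Prop :=
  ∀ W : Submodule K (G → K), TStable W → W ≠ ⊥ → ∃ i, 1 ≤ i ∧ i ≤ d ∧ (1 : G → K) ∈ W ^ i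

variable {K : Type*} [Field K] {G : Type*} [Group G]

lemma TStable.pow {W : Submodule K (G → K)} (h : TStable W) (i : ℕ) : TStable (W ^ i) := by
  intro g f hf
  have h1 : W.map (pbk K (fun x : G => x * g)).toLinearMap ≤ W := by
    rintro _ ⟨f, hf, rfl⟩
    exact h g f hf
  have h2 : (W ^ i).map (pbk K (fun x : G => x * g)).toLinearMap ≤ W ^ i := by
    rw [Submodule.map_pow]
    exact submodule_pow_mono h1 i
  exact h2 ⟨f, hf, rfl⟩

lemma SigBound.mono {d e : ℕ} (h : SigBound K G d) (hde : d ≤ e) : SigBound K G e := by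
  intro W hW h0
  obtain ⟨i, h1, h2, h3⟩ := h W hW h0
  exact ⟨i, h1, h2.trans hde, h3⟩

lemma TStable.exists_apply_one {W : Submodule K (G → K)} (h : TStable W) (h0 : W ≠ ⊥) :
    ∃ f ∈ W, f 1 ≠ 0 := by
  obtain ⟨f, hf, hne⟩ := W.ne_bot_iff.1 h0
  obtain ⟨x, hx⟩ := Function.ne_iff.1 hne
  exact ⟨_, h x f hf, by simpa using hx⟩

/-- a constant function -/
lemma one_mem_of_const {G : Type*} {U : Submodule K (G → K)} {f : G → K} (hf : f ∈ U) {c : K} (hc : c ≠ 0)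
    (h : ∀ x, f x = c) : (1 : G → K) ∈ U := by
  have : (1 : G → K) = c⁻¹ • f := by
    ext x; simp [h, hc]
  rw [this]
  exact U.smul_mem _ hf

lemma restrict_exists [Finite G] (H : Subgroup G) (hH : (Nat.card H : K) ≠ 0) {d : ℕ}
    (hd : SigBound K H d) {W : Submodule K (G → K)} (hW : TStable W) (h0 : W ≠ ⊥) :
    ∃ i, 1 ≤ i ∧ i ≤ d ∧ ∃ f ∈ W ^ i, (∀ x, ∀ k ∈ H, f (x * k) = f x) ∧ f 1 = 1 := by
  classical
  obtain ⟨f0, hf0, hf01⟩ := hW.exists_apply_one h0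
  set r := pbk K (fun x : H => (x : G)) with hr
  obtain ⟨i, h1, h2, h3⟩ := hd (W.map r.toLinearMap) (by
    rintro h _ ⟨f, hf, rfl⟩
    exact ⟨_, hW h f hf, rfl⟩) (by
    intro hb
    have : r f0 ∈ W.map r.toLinearMap := ⟨f0, hf0, rfl⟩
    rw [hb, Submodule.mem_bot] at this
    exact hf01 (congrFun this 1))
  rw [← Submodule.map_pow] at h3
  obtain ⟨f, hf, hfr⟩ := h3
  have hfr' : ∀ k : H, f k = 1 := fun k => congrFun hfr k
  have : Fintype H := Fintype.ofFinite _
  refine ⟨i, h1, h2, (Nat.card H : K)⁻¹ • ∑ k : H, pbk K (fun x => x * (k : G)) f, ?_, ?_, ?_⟩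
  · exact Submodule.smul_mem _ _ (Submodule.sum_mem _ fun k _ => hW.pow i k f hf)
  · intro x k hk
    simp only [Pi.smul_apply, Finset.sum_apply, pbk_apply]
    congr 1
    refine Fintype.sum_equiv (Equiv.mulLeft (⟨k, hk⟩ : H)) _ _ ?_
    intro y
    simp [mul_assoc]
  · simp only [Pi.smul_apply, Finset.sum_apply, pbk_apply, one_mul, hfr']
    simp
    rw [← Nat.card_eq_fintype_card]
    exact inv_mul_cancel₀ hH

lemma esymm_exists_ne_zero (s : Multiset K) {a : K} (ha : a ∈ s) (ha0 : a ≠ 0) :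
    ∃ j, 1 ≤ j ∧ j ≤ Multiset.card s ∧ s.esymm j ≠ 0 := by
  by_contra! hcon
  have h := Multiset.prod_X_sub_X_eq_sum_esymm s
  have h2 := congrArg (Polynomial.eval a) h
  rw [Polynomial.eval_multiset_prod, Finset.sum_range_succ', Polynomial.eval_add,
    Polynomial.eval_finsetSum, Finset.sum_eq_zero] at h2
  · rw [Multiset.prod_eq_zero] at h2
    · simp [Multiset.esymm] at h2
      exact pow_ne_zero _ ha0 h2.symm
    · rw [Multiset.mem_map]
      exact ⟨Polynomial.X - Polynomial.C a, Multiset.mem_map_of_mem _ ha, by simp⟩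
  · intro j hj
    rw [hcon (j + 1) (by omega) (by simpa using hj)]
    simp

lemma prod_mem_prod_submodule {R A ι : Type*} [CommSemiring R] [CommSemiring A] [Algebra R A]
    (s : Finset ι) (f : ι → A) (U : ι → Submodule R A) (h : ∀ i ∈ s, f i ∈ U i) :
    ∏ i ∈ s, f i ∈ ∏ i ∈ s, U i := by
  classical
  induction s using Finset.induction_on with
  | empty => exact Submodule.mem_one.2 ⟨1, by simp⟩
  | insert a s ha ih =>
    rw [Finset.prod_insert ha, Finset.prod_insert ha]
    exact Submodule.mul_mem_mul (h a (by simp)) (ih fun i hi => h i (by simp [hi]))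

lemma one_mem_pow_of_invariant [Finite G] (H : Subgroup G) {U : Submodule K (G → K)}
    (hU : TStable U) {f : G → K} (hf : f ∈ U) (hinv : ∀ x, ∀ k ∈ H, f (x * k) = f x)
    (h1 : f 1 ≠ 0) : ∃ j, 1 ≤ j ∧ j ≤ H.index ∧ (1 : G → K) ∈ U ^ j := by
  classical
  have : Fintype (G ⧸ H) := Fintype.ofFinite _
  let φ : G ⧸ H → K := Quotient.lift f (by
    intro a b hab
    have := hinv a (a⁻¹ * b) (QuotientGroup.leftRel_apply.1 hab)
    rw [← this]; simp)
  have hφ : ∀ x : G, φ (x : G ⧸ H) = f x := fun _ => rfl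
  let s : Multiset K := (Finset.univ : Finset (G ⧸ H)).val.map φ
  obtain ⟨j, hj1, hj2, hj3⟩ := esymm_exists_ne_zero s (a := f 1)
    (Multiset.mem_map.2 ⟨((1 : G) : G ⧸ H), by simp, hφ 1⟩) h1
  refine ⟨j, hj1, ?_, ?_⟩
  · have : Multiset.card s = H.index := by
      simp only [s, Multiset.card_map]
      rw [Subgroup.index, Nat.card_eq_fintype_card]; rfl
    omega
  · let e : G → K := ∑ t ∈ Finset.powersetCard j (Finset.univ : Finset (G ⧸ H)),
      ∏ c ∈ t, pbk K (fun x => x * c.out) f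
    have he : e ∈ U ^ j := by
      refine Submodule.sum_mem _ fun t ht => ?_
      have hcard := (Finset.mem_powersetCard.1 ht).2
      rw [← hcard, ← Finset.prod_const]
      exact prod_mem_prod_submodule _ _ _ fun c _ => hU _ _ hf
    refine one_mem_of_const he hj3 fun x => ?_
    have hx : s = (Finset.univ : Finset (G ⧸ H)).val.map (fun c => φ (x • c)) := by
      have := Finset.map_univ_equiv (MulAction.toPerm x : Equiv.Perm (G ⧸ H))
      have h2 := congrArg (fun z : Finset (G ⧸ H) => z.val.map φ) this
      simp only [Finset.map_val, Multiset.map_map] at h2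
      exact h2.symm
    rw [hx, Finset.esymm_map_val]
    simp only [e, Finset.sum_apply, Finset.prod_apply, pbk_apply]
    refine Finset.sum_congr rfl fun t _ => Finset.prod_congr rfl fun c _ => ?_
    rw [← hφ]
    congr 1
    conv_rhs => rw [← QuotientGroup.out_eq' c]
    rfl

lemma SigBound.of_subgroup [Finite G] (H : Subgroup G) (hH : (Nat.card H : K) ≠ 0) {d : ℕ}
    (hd : SigBound K H d) : SigBound K G (d * H.index) := by
  intro W hW h0
  obtain ⟨i, h1, h2, f, hf, hinv, hf1⟩ := restrict_exists H hH hd hW h0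
  obtain ⟨j, h3, h4, h5⟩ := one_mem_pow_of_invariant H (hW.pow i) hf hinv (by simp [hf1])
  refine ⟨i * j, Nat.mul_pos h1 h3, Nat.mul_le_mul h2 h4, ?_⟩
  rwa [pow_mul]

lemma SigBound.of_quotient [Finite G] (N : Subgroup G) [N.Normal] (hN : (Nat.card N : K) ≠ 0)
    {d e : ℕ} (hd : SigBound K N d) (he : SigBound K (G ⧸ N) e) : SigBound K G (d * e) := by
  intro W hW h0
  obtain ⟨i, h1, h2, f, hf, hinv, hf1⟩ := restrict_exists N hN hd hW h0
  set q := pbk K (fun x : G => (x : G ⧸ N)) with hq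
  obtain ⟨j, h3, h4, h5⟩ := he ((W ^ i).comap q.toLinearMap) (by
    intro c u hu
    obtain ⟨g, rfl⟩ := QuotientGroup.mk_surjective c
    exact hW.pow i g _ hu) (by
    let φ : G ⧸ N → K := Quotient.lift f (by
      intro a b hab
      have := hinv a (a⁻¹ * b) (QuotientGroup.leftRel_apply.1 hab)
      rw [← this]; simp)
    intro hb
    have : φ ∈ (W ^ i).comap q.toLinearMap := hf
    rw [hb, Submodule.mem_bot] at this
    have h := congrFun this ((1 : G) : G ⧸ N)
    change f 1 = 0 at h
    rw [hf1] at h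
    exact one_ne_zero h)
  refine ⟨i * j, Nat.mul_pos h1 h3, Nat.mul_le_mul h2 h4, ?_⟩
  have h6 : ((((W ^ i).comap q.toLinearMap) ^ j).map q.toLinearMap) ≤ (W ^ i) ^ j := by
    rw [Submodule.map_pow]
    exact submodule_pow_mono (Submodule.map_comap_le _ _) j
  rw [pow_mul]
  exact h6 ⟨1, h5, rfl⟩

lemma SigBound.card [Finite G] : SigBound K G (Nat.card G) := by
  have h : SigBound K (⊥ : Subgroup G) 1 := by
    intro W hW h0
    obtain ⟨f, hf, h1⟩ := hW.exists_apply_one h0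
    refine ⟨1, le_rfl, le_rfl, ?_⟩
    rw [pow_one]
    refine one_mem_of_const hf h1 fun x => ?_
    rw [Subsingleton.elim x 1]
  simpa using SigBound.of_subgroup (⊥ : Subgroup G) (by simp) h

lemma exists_eigen [IsAlgClosed K] [Finite G] {W : Submodule K (G → K)} (h0 : W ≠ ⊥) (g : G)
    (hW : ∀ f ∈ W, pbk K (fun x => x * g) f ∈ W) :
    ∃ c : K, ∃ f ∈ W, f ≠ 0 ∧ pbk K (fun x => x * g) f = c • f := by
  have : Nontrivial W := Submodule.nontrivial_iff_ne_bot.2 h0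
  let T : Module.End K W := (pbk K (fun x => x * g)).toLinearMap.restrict hW
  obtain ⟨c, hc⟩ := Module.End.exists_eigenvalue T
  obtain ⟨v, hv⟩ := hc.exists_hasEigenvector
  refine ⟨c, v, v.2, by simpa using hv.2, ?_⟩
  exact congrArg Subtype.val hv.apply_eq_smul

lemma SigBound.exponent [IsAlgClosed K] {G : Type*} [Group G] (hcomm : ∀ a b : G, a * b = b * a)
    [Finite G] : SigBound K G (Monoid.exponent G) := by
  intro W hW h0
  -- a minimal nonzero stable subspace
  obtain ⟨M, ⟨hM, hM0, hMW⟩, hmin⟩ := WellFounded.has_min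
    (wellFounded_lt : WellFounded ((· < ·) : Submodule K (G → K) → _ → Prop))
    {M | TStable M ∧ M ≠ ⊥ ∧ M ≤ W} ⟨W, hW, h0, le_rfl⟩
  have key : ∀ g : G, ∃ c : K, ∀ f ∈ M, pbk K (fun x => x * g) f = c • f := by
    intro g
    obtain ⟨c, f, hf, hf0, hfc⟩ := exists_eigen hM0 g (hM g)
    refine ⟨c, ?_⟩
    let E : Submodule K (G → K) :=
      M ⊓ LinearMap.ker ((pbk K (fun x => x * g)).toLinearMap - c • LinearMap.id)
    have hmem : ∀ u, u ∈ E ↔ u ∈ M ∧ pbk K (fun x => x * g) u = c • u := by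
      intro u
      simp [E, sub_eq_zero]
    have hE : E = M := by
      by_contra hne
      refine hmin E ⟨?_, ?_, inf_le_left.trans hMW⟩ (lt_of_le_of_ne inf_le_left hne)
      · intro h u hu
        rw [hmem] at hu ⊢
        refine ⟨hM h u hu.1, ?_⟩
        ext x
        have := congrFun hu.2 (x * h)
        simp only [pbk_apply, Pi.smul_apply] at this ⊢
        rw [← this, mul_assoc, mul_assoc, hcomm g h]
      · rw [Submodule.ne_bot_iff]
        exact ⟨f, (hmem f).2 ⟨hf, hfc⟩, hf0⟩
    intro u hu
    rw [← hE, hmem] at hu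
    exact hu.2
  choose c hc using key
  obtain ⟨f, hf, hf1⟩ := hM.exists_apply_one hM0
  have hval : ∀ x g : G, f (x * g) = c g * f x := fun x g => congrFun (hc g f hf) x
  have hpow : ∀ (g : G) (k : ℕ), f (g ^ k) = c g ^ k * f 1 := by
    intro g k
    induction k with
    | zero => simp
    | succ k ih => rw [pow_succ, hval, ih, pow_succ]; ring
  refine ⟨Monoid.exponent G, Nat.pos_of_ne_zero Monoid.exponent_ne_zero_of_finite, le_rfl, ?_⟩
  refine one_mem_of_const (f := f ^ Monoid.exponent G) (Submodule.pow_mem_pow _ (hMW hf) _)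
    (pow_ne_zero (Monoid.exponent G) hf1) fun x => ?_
  have h1 := hval 1 x
  have h2 := hpow x (Monoid.exponent G)
  rw [Monoid.pow_exponent_eq_one] at h2
  have h3 : c x ^ Monoid.exponent G = 1 := by
    have : (c x ^ Monoid.exponent G - 1) * f 1 = 0 := by linear_combination -h2
    rcases mul_eq_zero.1 this with h | h
    · exact sub_eq_zero.1 h
    · exact absurd h hf1
  rw [one_mul] at h1
  rw [Pi.pow_apply, h1, mul_pow, h3, one_mul]

end FunctionSpace

section ZeroSum

open scoped Pointwise

lemma zero_sum_aux {p : ℕ} (hp : p.Prime) {ι : Type*} [DecidableEq ι] (S : Finset ι)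
    (a : ι → ZMod p) (ha : Set.InjOn a S) (ha0 : ∀ i ∈ S, a i ≠ 0) (j : ℕ) :
    ∃ R : Finset (ZMod p), R.Nonempty ∧ min p (1 + j * S.card) ≤ R.card ∧
      ∀ t ∈ R, ∃ e : ι → ℕ, (∀ i ∉ S, e i = 0) ∧ ∑ i ∈ S, e i ≤ j ∧
        ∑ i ∈ S, (e i : ZMod p) * a i = t := by
  classical
  induction j with
  | zero =>
    refine ⟨{0}, by simp, by simp, ?_⟩
    intro t ht
    rw [Finset.mem_singleton] at ht
    exact ⟨0, by simp, by simp, by simp [ht]⟩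
  | succ j ih =>
    obtain ⟨R, hR, hcard, hrep⟩ := ih
    set A : Finset (ZMod p) := insert 0 (S.image a) with hA
    have hAc : A.card = S.card + 1 := by
      rw [hA, Finset.card_insert_of_notMem, Finset.card_image_of_injOn ha]
      intro h
      obtain ⟨i, hi, h0⟩ := Finset.mem_image.1 h
      exact ha0 i hi h0
    have hcd := ZMod.cauchy_davenport hp hR (show A.Nonempty from ⟨0, by simp [hA]⟩)
    refine ⟨R + A, hR.add ⟨0, by simp [hA]⟩, ?_, ?_⟩
    · have : (j + 1) * S.card = j * S.card + S.card := by ring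
      omega
    · intro t ht
      obtain ⟨u, hu, b, hb, rfl⟩ := Finset.mem_add.1 ht
      obtain ⟨e, h1, h2, h3⟩ := hrep u hu
      rw [hA, Finset.mem_insert] at hb
      rcases hb with rfl | hb
      · exact ⟨e, h1, by omega, by rw [h3, add_zero]⟩
      · obtain ⟨i, hi, rfl⟩ := Finset.mem_image.1 hb
        refine ⟨e + Pi.single i 1, ?_, ?_, ?_⟩
        · intro k hk
          have : k ≠ i := fun h => hk (h ▸ hi)
          simp [h1 k hk, this]
        · simp only [Pi.add_apply, Finset.sum_add_distrib]
          simp [hi]; exact h2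
        · simp only [Pi.add_apply, Nat.cast_add, add_mul, Finset.sum_add_distrib, h3]
          congr 1
          rw [Finset.sum_eq_single i]
          · simp
          · intro k _ hk
            simp [hk]
          · intro h; exact absurd hi h

lemma zero_sum_exists {p : ℕ} (hp : p.Prime) {ι : Type*} [DecidableEq ι] (S : Finset ι)
    (hS : S.Nonempty) (hSp : S.card < p)
    (a : ι → ZMod p) (ha : Set.InjOn a S) (ha0 : ∀ i ∈ S, a i ≠ 0) :
    ∃ e : ι → ℕ, (∀ i ∈ S, e i ≠ 0) ∧ ∑ i ∈ S, e i ≤ p ∧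
        ∑ i ∈ S, (e i : ZMod p) * a i = 0 := by
  have : Fact p.Prime := ⟨hp⟩
  obtain ⟨R, hR, hcard, hrep⟩ := zero_sum_aux hp S a ha ha0 (p - S.card)
  have hle : p ≤ 1 + (p - S.card) * S.card := by
    obtain ⟨k, hk⟩ : ∃ k, S.card = k + 1 := ⟨S.card - 1, by have := hS.card_pos; omega⟩
    obtain ⟨l, hl⟩ : ∃ l, p = S.card + l + 1 := ⟨p - S.card - 1, by omega⟩
    have h2 : p - S.card = l + 1 := by omega
    rw [h2, hl, hk]
    nlinarith [Nat.zero_le (k * l)]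
  have hRu : R = Finset.univ := by
    rw [← Finset.card_eq_iff_eq_univ, ZMod.card]
    refine le_antisymm ?_ ?_
    · simpa [ZMod.card] using Finset.card_le_univ R
    · omega
  obtain ⟨e, h1, h2, h3⟩ := hrep (-∑ i ∈ S, a i) (by rw [hRu]; simp)
  refine ⟨e + 1, by simp, ?_, ?_⟩
  · simp only [Pi.add_apply, Finset.sum_add_distrib, Pi.one_apply, Finset.sum_const, smul_eq_mul,
      mul_one]
    omega
  · simp only [Pi.add_apply, Pi.one_apply, Nat.cast_add, Nat.cast_one, add_mul, one_mul,
      Finset.sum_add_distrib, h3]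
    simp

end ZeroSum

section Base

variable {K : Type*} [Field K] {G : Type*} [Group G]

lemma const_of_gen {K : Type*} {n g : G} (hgen : Subgroup.closure {n, g} = ⊤) {f : G → K}
    (hn : ∀ x, f (x * n) = f x) (hg : ∀ x, f (x * g) = f x) (x y : G) : f x = f y := by
  have key : ∀ h : G, ∀ x, f (x * h) = f x := by
    intro h
    have hh : h ∈ Subgroup.closure {n, g} := by rw [hgen]; trivial
    induction hh using Subgroup.closure_induction with
    | mem z hz =>
      rcases hz with rfl | hz
      · exact hn
      · rw [Set.mem_singleton_iff] at hz
        subst hz; exact hg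
    | one => simp
    | mul a b _ _ ha hb => intro x; rw [← mul_assoc, hb, ha]
    | inv a _ ha => intro x; rw [← ha (x * a⁻¹)]; simp
  have := key (x⁻¹ * y) x
  rw [← this]; simp

lemma SigBound.base [IsAlgClosed K] [Finite G] {p r : ℕ} (hp : p.Prime) (hr : r.Prime)
    (hrp : r ≤ p) {n g : G} (hgen : Subgroup.closure {n, g} = ⊤) (hnp : n ^ p = 1)
    (hgr : g ^ r = 1) (s : ℕ) (hs : n * g = g * n ^ s)
    (hsr : (s : ZMod p) ^ r = 1) (hs1 : (s : ZMod p) ≠ 1) : SigBound K G p := by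
  classical
  have : Fact p.Prime := ⟨hp⟩
  have : Fact r.Prime := ⟨hr⟩
  intro W hW h0
  obtain ⟨ζ, f, hf, hf0, hfe⟩ := exists_eigen h0 n (hW n)
  obtain ⟨y, hy⟩ := Function.ne_iff.1 hf0
  replace hy : f y ≠ 0 := hy
  have hfe' : ∀ x, f (x * n) = ζ * f x := fun x => congrFun hfe x
  have hfk : ∀ (k : ℕ) x, f (x * n ^ k) = ζ ^ k * f x := by
    intro k
    induction k with
    | zero => simp
    | succ k ih => intro x; rw [pow_succ, ← mul_assoc, hfe', ih]; ring
  have hζ : ζ ^ p = 1 := by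
    have h := hfk p y
    rw [hnp, mul_one] at h
    have : (ζ ^ p - 1) * f y = 0 := by linear_combination -h
    rcases mul_eq_zero.1 this with h | h
    · exact sub_eq_zero.1 h
    · exact absurd h hy
  have hs' : ∀ k : ℕ, n ^ k * g = g * n ^ (s * k) := by
    intro k
    induction k with
    | zero => simp
    | succ k ih => 
      rw [pow_succ, mul_assoc, hs, ← mul_assoc, ih, mul_assoc, ← pow_add]; ring_nf
  have hcomm : ∀ i : ℕ, n * g ^ i = g ^ i * n ^ (s ^ i) := by
    intro i
    induction i with
    | zero => simp
    | succ i ih => 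
      rw [pow_succ, ← mul_assoc, ih, mul_assoc, hs', ← mul_assoc]; ring_nf
  let X : ZMod r → G → K := fun i => pbk K (fun x => x * g ^ i.val) f
  have hXW : ∀ i, X i ∈ W := fun i => hW _ _ hf
  have hXn : ∀ i x, X i (x * n) = ζ ^ (s ^ i.val) * X i x := by
    intro i x
    simp only [X, pbk_apply]
    rw [mul_assoc, hcomm, ← mul_assoc, hfk]
  have hXg : ∀ i (j : ZMod r) x, X i (x * g ^ j.val) = X (j + i) x := by
    intro i j x
    simp only [X, pbk_apply]
    rw [mul_assoc, ← pow_add, pow_eq_pow_mod _ hgr, ← ZMod.val_add]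
  have hXg1 : ∀ i x, X i (x * g) = X (1 + i) x := by
    intro i x
    have := hXg i 1 x
    rwa [ZMod.val_one, pow_one] at this
  have hpowζ : ∀ k : ℕ, (k : ZMod p) = 0 → ζ ^ k = 1 := by
    intro k hk
    obtain ⟨m, rfl⟩ := (ZMod.natCast_eq_zero_iff k p).1 hk
    rw [pow_mul, hζ, one_pow]
  have hord : orderOf (s : ZMod p) = r := orderOf_eq_prime hsr hs1
  -- the full product
  have hcardr : Fintype.card (ZMod r) = r := ZMod.card r
  have hinj : Function.Injective (fun i : ZMod r => (s : ZMod p) ^ i.val) := by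
    intro i j hij
    have := pow_injOn_Iio_orderOf (x := (s : ZMod p)) (by simpa [hord] using i.val_lt)
      (by simpa [hord] using j.val_lt) hij
    exact ZMod.val_injective r this
  have hs0 : (s : ZMod p) ≠ 0 := by
    intro h
    rw [h, zero_pow hr.ne_zero] at hsr
    exact zero_ne_one hsr
  have hsum : ∑ i : ZMod r, (s : ZMod p) ^ i.val = 0 := by
    have h1 : ∑ i : ZMod r, (s : ZMod p) ^ i.val = ∑ i ∈ Finset.range r, (s : ZMod p) ^ i := by
      refine Finset.sum_bij (fun i _ => i.val) ?_ ?_ ?_ ?_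
      · intro i _; simpa using i.val_lt
      · intro i _ j _ h; exact ZMod.val_injective r h
      · intro b hb
        exact ⟨(b : ZMod r), by simp, ZMod.val_cast_of_lt (by simpa using hb)⟩
      · intro i _; rfl
    have h2 := geom_sum_mul (s : ZMod p) r
    rw [hsr, sub_self] at h2
    rw [h1]
    exact (mul_eq_zero.1 h2).resolve_right (sub_ne_zero.2 hs1)
  let T : G → K := ∏ i, X i
  have hT : T ∈ W ^ r := by
    have := prod_mem_prod_submodule Finset.univ X (fun _ => W) fun i _ => hXW i
    rwa [Finset.prod_const, Finset.card_univ, hcardr] at this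
  have hTapp : ∀ x, T x = ∏ i, X i x := fun x => by simp [T]
  have hTc : ∀ x z, T x = T z := by
    refine const_of_gen hgen ?_ ?_
    · intro x
      simp only [hTapp, hXn, Finset.prod_mul_distrib]
      rw [Finset.prod_pow_eq_pow_sum, hpowζ, one_mul]
      push_cast
      exact hsum
    · intro x
      simp only [hTapp, hXg1]
      exact Fintype.prod_equiv (Equiv.addLeft 1) _ _ fun i => rfl
  by_cases hTy : T y = 0
  swap
  · exact ⟨r, hr.one_lt.le, hrp, one_mem_of_const hT hTy fun x => hTc x y⟩
  let S : Finset (ZMod r) := Finset.univ.filter fun i => X i y ≠ 0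
  have hS0 : (0 : ZMod r) ∈ S := Finset.mem_filter.2 ⟨Finset.mem_univ _, by simpa [X] using hy⟩
  obtain ⟨i0, hi0⟩ : ∃ i, X i y = 0 := by
    rw [hTapp, Finset.prod_eq_zero_iff] at hTy
    obtain ⟨i, _, hi⟩ := hTy
    exact ⟨i, hi⟩
  have hi0S : i0 ∉ S := by simp [S, hi0]
  have hSr : S.card < r := by
    refine lt_of_lt_of_eq ((Finset.card_lt_iff_ne_univ S).2 ?_) hcardr
    intro h; rw [h] at hi0S; simp at hi0S
  obtain ⟨e, he1, he2, he3⟩ := zero_sum_exists hp S ⟨0, hS0⟩ (by omega)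
    (fun i => (s : ZMod p) ^ i.val) hinj.injOn fun i _ => pow_ne_zero _ hs0
  let M : G → K := ∏ i ∈ S, X i ^ e i
  have hM : M ∈ W ^ (∑ i ∈ S, e i) := by
    rw [← Finset.prod_pow_eq_pow_sum]
    exact prod_mem_prod_submodule S _ _ fun i _ => Submodule.pow_mem_pow _ (hXW i) _
  have hMapp : ∀ x, M x = ∏ i ∈ S, X i x ^ e i := fun x => by simp [M]
  let Q : G → K := ∑ j : ZMod r, pbk K (fun x => x * g ^ j.val) M
  have hQ : Q ∈ W ^ (∑ i ∈ S, e i) := Submodule.sum_mem _ fun j _ => hW.pow _ _ _ hM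
  have hQapp : ∀ x, Q x = ∑ j : ZMod r, ∏ i ∈ S, X (j + i) x ^ e i := by
    intro x
    simp only [Q, Finset.sum_apply, pbk_apply, hMapp, hXg]
  have hQc : ∀ x z, Q x = Q z := by
    refine const_of_gen hgen ?_ ?_
    · intro x
      simp only [hQapp, hXn, mul_pow, Finset.prod_mul_distrib]
      refine Finset.sum_congr rfl fun j _ => ?_
      rw [Finset.prod_congr rfl (fun i _ => (pow_mul ζ (s ^ (j + i).val) (e i)).symm),
        Finset.prod_pow_eq_pow_sum, hpowζ, one_mul]
      have h1 : ∀ i : ZMod r, (s : ZMod p) ^ (j + i).val = (s : ZMod p) ^ j.val * s ^ i.val := by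
        intro i
        rw [ZMod.val_add, ← pow_eq_pow_mod _ hsr, pow_add]
      push_cast
      simp only [h1]
      rw [Finset.sum_congr rfl (fun i _ => (by ring :
        (s : ZMod p) ^ j.val * s ^ i.val * e i = s ^ j.val * (e i * s ^ i.val))),
        ← Finset.mul_sum, he3, mul_zero]
    · intro x
      simp only [hQapp, hXg1]
      exact Fintype.sum_equiv (Equiv.addLeft 1) _ _ fun j => by simp [add_assoc]
  have hQy : Q y = ∏ i ∈ S, X i y ^ e i := by
    rw [hQapp, Finset.sum_eq_single 0]
    · simp
    · intro j _ hj
      by_contra hne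
      rw [Finset.prod_eq_zero_iff] at hne
      push Not at hne
      have hstep : ∀ i ∈ S, j + i ∈ S := by
        intro i hi
        simp only [S, Finset.mem_filter, Finset.mem_univ, true_and]
        intro h
        exact hne i hi (by rw [h, zero_pow (he1 i hi)])
      have hmul : ∀ k : ℕ, (k : ZMod r) * j ∈ S := by
        intro k
        induction k with
        | zero => simpa using hS0
        | succ k ih => 
          have := hstep _ ih
          rwa [show j + (k : ZMod r) * j = ((k + 1 : ℕ) : ZMod r) * j by push_cast; ring] at this
      apply hi0S
      have := hmul (i0 * j⁻¹).val
      rwa [ZMod.natCast_zmod_val, mul_assoc, inv_mul_cancel₀ hj, mul_one] at this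
    · simp
  refine ⟨∑ i ∈ S, e i, ?_, he2, one_mem_of_const hQ (c := Q y) ?_ fun x => hQc x y⟩
  · have := Finset.single_le_sum (f := e) (fun i _ => Nat.zero_le _) hS0
    have := he1 0 hS0
    omega
  · rw [hQy, Finset.prod_ne_zero_iff]
    intro i hi
    exact pow_ne_zero _ (by simpa [S] using hi)

end Base

section GroupInduction

lemma mem_zpowers_of_cyclic {D : Type*} [Group D] [Finite D] [IsCyclic D] {a b : D}
    (hb : b ^ orderOf a = 1) : b ∈ Subgroup.zpowers a := by
  classical
  have : Fintype D := Fintype.ofFinite D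
  have h1 := IsCyclic.card_pow_eq_one_le (α := D) (orderOf_pos a)
  have h2 : (Finset.univ.filter fun x => x ∈ Subgroup.zpowers a) ⊆
      Finset.univ.filter fun x : D => x ^ orderOf a = 1 := by
    intro x hx
    simp only [Finset.mem_filter, Finset.mem_univ, true_and] at hx ⊢
    obtain ⟨k, rfl⟩ := Subgroup.mem_zpowers_iff.1 hx
    rw [← zpow_natCast, zpow_comm, zpow_natCast, pow_orderOf_eq_one, one_zpow]
  have h3 : (Finset.univ.filter fun x => x ∈ Subgroup.zpowers a).card = orderOf a := by
    rw [← Nat.card_zpowers, Nat.card_eq_fintype_card, Fintype.card_subtype]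
  have h4 := Finset.eq_of_subset_of_card_le h2 (by rw [h3]; exact h1)
  have : b ∈ Finset.univ.filter fun x => x ∈ Subgroup.zpowers a := by
    rw [h4]; simpa using hb
  simpa using this

lemma SigBound.minimal {K : Type*} [Field K] [IsAlgClosed K] {G : Type*} [Group G] [Finite G]
    (hnc : ¬ ∀ a b : G, a * b = b * a)
    (hsub : ∀ H : Subgroup G, H ≠ ⊤ → IsCyclic H)
    (hquo : ∀ (N : Subgroup G) [N.Normal], N ≠ ⊥ → IsCyclic (G ⧸ N)) :
    SigBound K G (Nat.card G / (Nat.card G).minFac) := by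
  classical
  have hcenter : Subgroup.center G = ⊥ := by
    by_contra h
    have := hquo _ h
    exact hnc fun a b => (isMulCommutative_of_isCyclic_quotient_center_self (G := G)).is_comm.comm a b
  have hnt : Nontrivial G := by
    by_contra h
    rw [not_nontrivial_iff_subsingleton] at h
    exact hnc fun a b => Subsingleton.elim _ _
  have hZ : IsZGroup G := by
    refine ⟨fun p hp P => ?_⟩
    have : Fact p.Prime := ⟨hp⟩
    refine hsub _ fun h => ?_
    have hP := P.isPGroup'
    have hG : IsPGroup p G := by
      intro x
      obtain ⟨k, hk⟩ := hP ⟨x, by rw [h]; trivial⟩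
      exact ⟨k, by simpa [Subtype.ext_iff] using hk⟩
    have := hG.center_nontrivial
    rw [hcenter] at this
    exact not_subsingleton (⊥ : Subgroup G) inferInstance
  have hcyc : IsCyclic (commutator G) := IsZGroup.isCyclic_commutator G
  have hcne : commutator G ≠ ⊥ := by
    intro h
    rw [commutator_eq_bot_iff] at h
    exact hnc fun a b => h.is_comm.comm a b
  have hcard : Nat.card (commutator G) ≠ 1 := by
    rwa [Ne, Subgroup.card_eq_one]
  obtain ⟨p, hp, hpd⟩ := Nat.exists_prime_and_dvd hcard
  have : Fact p.Prime := ⟨hp⟩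
  obtain ⟨n', hn'⟩ := exists_prime_orderOf_dvd_card' p hpd
  set n : G := n'.val with hn
  have hnord : orderOf n = p := by rw [hn, Subgroup.orderOf_coe, hn']
  have hconj : ∀ g : G, g * n * g⁻¹ ∈ Subgroup.zpowers n := by
    intro g
    have hm : g * n * g⁻¹ ∈ commutator G :=
      (inferInstance : (commutator G).Normal).conj_mem n n'.2 g
    have h1 : (⟨g * n * g⁻¹, hm⟩ : commutator G) ∈ Subgroup.zpowers n' := by
      apply mem_zpowers_of_cyclic
      rw [hn', Subtype.ext_iff]
      simp only [SubmonoidClass.coe_pow, OneMemClass.coe_one]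
      rw [conj_pow, ← hnord, pow_orderOf_eq_one]; simp
    obtain ⟨k, hk⟩ := Subgroup.mem_zpowers_iff.1 h1
    refine Subgroup.mem_zpowers_iff.2 ⟨k, ?_⟩
    simpa [Subtype.ext_iff] using hk
  have hnne : n ≠ 1 := by
    intro h
    rw [h, orderOf_one] at hnord
    exact hp.one_lt.ne hnord
  have hnz : n ∉ Subgroup.center G := by
    rw [hcenter]; simpa using hnne
  obtain ⟨g0, hg0⟩ : ∃ g0 : G, ¬ Commute g0 n := by
    by_contra! h
    exact hnz (Subgroup.mem_center_iff.2 fun g => h g)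
  -- an element of prime order modulo the centralizer
  have hex : ∃ k, 0 < k ∧ Commute (g0 ^ k) n :=
    ⟨orderOf g0, orderOf_pos g0, by rw [pow_orderOf_eq_one]; exact Commute.one_left n⟩
  obtain ⟨hk0, hkc⟩ := Nat.find_spec hex
  set k := Nat.find hex with hk
  have hk1 : k ≠ 1 := by
    intro h
    rw [h, pow_one] at hkc
    exact hg0 hkc
  obtain ⟨r, hr, l, hl⟩ := Nat.exists_prime_and_dvd hk1
  have hl0 : 0 < l := by
    rcases Nat.eq_zero_or_pos l with h | h
    · rw [h] at hl; omega
    · exact h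
  have hlk : l < k := by
    have := hr.one_lt
    nlinarith
  set g : G := g0 ^ l with hg
  have hgn : ¬ Commute g n := fun h => Nat.find_min hex hlk ⟨hl0, h⟩
  have hgr' : Commute (g ^ r) n := by
    rw [hg, ← pow_mul, mul_comm l r, ← hl]; exact hkc
  have hgen : Subgroup.closure {n, g} = ⊤ := by
    by_contra h
    have hc := hsub _ h
    have hn1 : n ∈ Subgroup.closure {n, g} := Subgroup.subset_closure (by simp)
    have hg1 : g ∈ Subgroup.closure {n, g} := Subgroup.subset_closure (by simp)
    have := (IsCyclic.isMulCommutative (α := Subgroup.closure {n, g})).is_comm.comm (⟨g, hg1⟩ : Subgroup.closure {n, g}) ⟨n, hn1⟩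
    exact hgn (congrArg Subtype.val this)
  have hgr : g ^ r = 1 := by
    have : g ^ r ∈ Subgroup.center G := by
      have h1 : Subgroup.closure {n, g} ≤ Subgroup.centralizer {g ^ r} := by
        rw [Subgroup.closure_le]
        rintro x (rfl | hx)
        · exact Subgroup.mem_centralizer_singleton_iff.2 hgr'.symm.eq
        · rw [Set.mem_singleton_iff] at hx
          rw [hx]
          exact Subgroup.mem_centralizer_singleton_iff.2 (Commute.self_pow g r).eq
      rw [hgen] at h1
      refine Subgroup.mem_center_iff.2 fun x => ?_
      exact Subgroup.mem_centralizer_singleton_iff.1 (h1 (Subgroup.mem_top x))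
    rwa [hcenter, Subgroup.mem_bot] at this
  obtain ⟨s, hs⟩ : ∃ s : ℕ, n ^ s = g⁻¹ * n * g := by
    have := hconj g⁻¹
    rw [inv_inv, ← mem_powers_iff_mem_zpowers] at this
    exact Submonoid.mem_powers_iff _ _ |>.1 this
  have hsg : n * g = g * n ^ s := by rw [hs]; group
  have hs' : ∀ k : ℕ, n ^ k * g = g * n ^ (s * k) := by
    intro k
    induction k with
    | zero => simp
    | succ k ih =>
      rw [pow_succ, mul_assoc, hsg, ← mul_assoc, ih, mul_assoc, ← pow_add]; ring_nf
  have hcomm : ∀ i : ℕ, n * g ^ i = g ^ i * n ^ (s ^ i) := by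
    intro i
    induction i with
    | zero => simp
    | succ i ih =>
      rw [pow_succ, ← mul_assoc, ih, mul_assoc, hs', ← mul_assoc]; ring_nf
  have hsr : (s : ZMod p) ^ r = 1 := by
    have h1 := hcomm r
    rw [hgr, mul_one, one_mul] at h1
    have h2 : n ^ 1 = n ^ (s ^ r) := by rw [pow_one]; exact h1
    rw [pow_eq_pow_iff_modEq, hnord, ← ZMod.natCast_eq_natCast_iff] at h2
    push_cast at h2
    exact h2.symm
  have hs1 : (s : ZMod p) ≠ 1 := by
    intro h
    have h2 : ((s : ℕ) : ZMod p) = ((1 : ℕ) : ZMod p) := by rw [h, Nat.cast_one]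
    rw [ZMod.natCast_eq_natCast_iff, ← hnord, ← pow_eq_pow_iff_modEq, pow_one] at h2
    rw [h2] at hsg
    exact hgn hsg.symm
  have : Fact r.Prime := ⟨hr⟩
  have hrp : r ≤ p := by
    have hs0 : (s : ZMod p) ≠ 0 := by
      intro h
      rw [h, zero_pow hr.ne_zero] at hsr
      exact zero_ne_one hsr
    have h1 := ZMod.orderOf_dvd_card_sub_one hs0
    rw [orderOf_eq_prime hsr hs1] at h1
    have := Nat.le_of_dvd (by have := hp.two_le; omega) h1
    omega
  have hbase : SigBound K G p := SigBound.base hp hr hrp hgen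
    (by rw [← hnord, pow_orderOf_eq_one]) hgr s hsg hsr hs1
  refine hbase.mono ?_
  rw [Nat.le_div_iff_mul_le (Nat.minFac_pos _)]
  have hci := Subgroup.card_mul_index (Subgroup.zpowers n)
  rw [Nat.card_zpowers, hnord] at hci
  have hi1 : (Subgroup.zpowers n).index ≠ 1 := by
    intro h
    rw [Subgroup.index_eq_one] at h
    have : g ∈ Subgroup.zpowers n := by rw [h]; trivial
    obtain ⟨k, hk⟩ := Subgroup.mem_zpowers_iff.1 this
    exact hgn (hk ▸ (Commute.refl n).zpow_left k)
  have hi0 : (Subgroup.zpowers n).index ≠ 0 := Subgroup.index_ne_zero_of_finite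
  have := Nat.minFac_le_of_dvd (n := Nat.card G) (m := (Subgroup.zpowers n).index) (by omega)
    (Subgroup.index_dvd_card _)
  calc p * (Nat.card G).minFac ≤ p * (Subgroup.zpowers n).index := Nat.mul_le_mul_left _ this
    _ = _ := hci

lemma SigBound.of_not_isCyclic {K : Type*} [Field K] [IsAlgClosed K] (m : ℕ) :
    ∀ {G : Type*} [Group G] [Finite G], Nat.card G = m → (Nat.card G : K) ≠ 0 → ¬ IsCyclic G →
      SigBound K G (Nat.card G / (Nat.card G).minFac) := by
  induction m using Nat.strong_induction_on with
  | _ m ih =>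
  intro G _ _ hm hK hnc
  have hpos : 0 < Nat.card G := Nat.card_pos
  by_cases hsub : ∀ H : Subgroup G, H ≠ ⊤ → IsCyclic H
  swap
  · push Not at hsub
    obtain ⟨H, hH, hHc⟩ := hsub
    have hci := Subgroup.card_mul_index H
    have hcH : Nat.card H < Nat.card G := by
      refine lt_of_le_of_ne (Subgroup.card_le_card_group H) fun h => hH ?_
      exact Subgroup.eq_top_of_card_eq H h
    have hHK : (Nat.card H : K) ≠ 0 := by
      intro h; apply hK; rw [← hci]; push_cast; rw [h, zero_mul]
    have hH1 : Nat.card H ≠ 1 := by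
      intro h
      have : Subsingleton H := (Nat.card_eq_one_iff_unique.1 h).1
      exact hHc inferInstance
    refine (SigBound.of_subgroup H hHK (ih _ (hm ▸ hcH) rfl hHK hHc)).mono ?_
    rw [Nat.le_div_iff_mul_le (Nat.minFac_pos _)]
    have hq := Nat.minFac_le_of_dvd (n := Nat.card G) (Nat.minFac_prime hH1).two_le
      ((Nat.minFac_dvd _).trans (Subgroup.card_subgroup_dvd_card H))
    calc Nat.card H / (Nat.card H).minFac * H.index * (Nat.card G).minFac
        ≤ Nat.card H / (Nat.card H).minFac * H.index * (Nat.card H).minFac :=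
          Nat.mul_le_mul_left _ hq
      _ = (Nat.card H / (Nat.card H).minFac * (Nat.card H).minFac) * H.index := by ring
      _ = Nat.card G := by rw [Nat.div_mul_cancel (Nat.minFac_dvd _), hci]
  by_cases hquo : ∀ (N : Subgroup G) [N.Normal], N ≠ ⊥ → IsCyclic (G ⧸ N)
  swap
  · push Not at hquo
    obtain ⟨N, hN, hNb, hNc⟩ := hquo
    have hci := Subgroup.card_mul_index N
    have hi : Nat.card (G ⧸ N) = N.index := rfl
    rw [← hi] at hci
    have hN1 : Nat.card N ≠ 1 := by rwa [Ne, Subgroup.card_eq_one]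
    have hN0 : 0 < Nat.card N := Nat.card_pos
    have hQ0 : 0 < Nat.card (G ⧸ N) := Nat.card_pos
    have hcQ : Nat.card (G ⧸ N) < Nat.card G := by
      have : 2 ≤ Nat.card N := by omega
      nlinarith
    have hNK : (Nat.card N : K) ≠ 0 := by
      intro h; apply hK; rw [← hci]; push_cast; rw [h, zero_mul]
    have hQK : (Nat.card (G ⧸ N) : K) ≠ 0 := by
      intro h; apply hK; rw [← hci]; push_cast; rw [h, mul_zero]
    have hQ1 : Nat.card (G ⧸ N) ≠ 1 := by
      intro h
      have : Subsingleton (G ⧸ N) := (Nat.card_eq_one_iff_unique.1 h).1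
      exact hNc inferInstance
    refine (SigBound.of_quotient N hNK SigBound.card (ih _ (hm ▸ hcQ) rfl hQK hNc)).mono ?_
    rw [Nat.le_div_iff_mul_le (Nat.minFac_pos _)]
    have hq := Nat.minFac_le_of_dvd (n := Nat.card G) (Nat.minFac_prime hQ1).two_le
      ((Nat.minFac_dvd _).trans (Dvd.intro_left _ hci))
    calc Nat.card N * (Nat.card (G ⧸ N) / (Nat.card (G ⧸ N)).minFac) * (Nat.card G).minFac
        ≤ Nat.card N * (Nat.card (G ⧸ N) / (Nat.card (G ⧸ N)).minFac)
          * (Nat.card (G ⧸ N)).minFac := Nat.mul_le_mul_left _ hq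
      _ = Nat.card G := by rw [mul_assoc, Nat.div_mul_cancel (Nat.minFac_dvd _), hci]
  by_cases hcomm : ∀ a b : G, a * b = b * a
  · refine (SigBound.exponent hcomm).mono ?_
    rw [Nat.le_div_iff_mul_le (Nat.minFac_pos _)]
    obtain ⟨c, hc⟩ := Group.exponent_dvd_nat_card (G := G)
    have hc1 : c ≠ 1 := by
      intro h
      rw [h, mul_one] at hc
      let _ : CommGroup G := { (inferInstance : Group G) with mul_comm := hcomm }
      exact hnc (IsCyclic.of_exponent_eq_card hc.symm)
    have hc0 : c ≠ 0 := by
      intro h; rw [h, mul_zero] at hc; omega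
    have := Nat.minFac_le_of_dvd (n := Nat.card G) (m := c) (by omega) (Dvd.intro_left _ hc.symm)
    calc Monoid.exponent G * (Nat.card G).minFac ≤ Monoid.exponent G * c :=
          Nat.mul_le_mul_left _ this
      _ = _ := hc.symm
  · exact SigBound.minimal hcomm hsub hquo

end GroupInduction

section Bridge

variable {F : Type*} [Field F] {G : Type*} [Group G] {n : ℕ}

lemma polyAct_X (ρ : Representation F G (Fin n → F)) (g : G) (i : Fin n) :
    polyAct ρ g (X i) = ∑ j, (ρ g (Pi.single j 1) i) • X j := by
  simp [polyAct]

lemma polyAct_mul (ρ : Representation F G (Fin n → F)) (g h : G) (f : MvPolynomial (Fin n) F) :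
    polyAct ρ (g * h) f = polyAct ρ h (polyAct ρ g f) := by
  have : polyAct ρ (g * h) = (polyAct ρ h).comp (polyAct ρ g) := by
    refine MvPolynomial.algHom_ext fun i => ?_
    rw [AlgHom.comp_apply, polyAct_X, polyAct_X, map_sum]
    simp only [map_smul, polyAct_X, Finset.smul_sum, smul_smul]
    rw [Finset.sum_comm]
    refine Finset.sum_congr rfl fun j _ => ?_
    rw [← Finset.sum_smul]
    congr 1
    rw [map_mul, Module.End.mul_apply]
    generalize ρ h (Pi.single j 1) = w
    have hw : w = ∑ k, w k • (Pi.single k 1 : Fin n → F) := by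
      ext a; simp [Finset.sum_apply, Pi.single_apply]
    conv_lhs => rw [hw]
    simp only [map_sum, map_smul, Finset.sum_apply, Pi.smul_apply, smul_eq_mul]
    exact Finset.sum_congr rfl fun k _ => mul_comm _ _
  rw [this]; rfl

lemma polyAct_one (ρ : Representation F G (Fin n → F)) (f : MvPolynomial (Fin n) F) :
    polyAct ρ 1 f = f := by
  have : polyAct ρ (1 : G) = AlgHom.id F _ := by
    refine MvPolynomial.algHom_ext fun i => ?_
    rw [polyAct_X, Finset.sum_eq_single i]
    · simp
    · intro j _ hj
      simp [hj.symm]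
    · simp
  rw [this]; rfl

lemma polyAct_isHomogeneous (ρ : Representation F G (Fin n → F)) (g : G)
    {f : MvPolynomial (Fin n) F} {d : ℕ} (hf : f.IsHomogeneous d) :
    (polyAct ρ g f).IsHomogeneous d := by
  have := hf.aeval (n := 1) (fun i => ∑ j, (ρ g (Pi.single j 1) i) • X j : Fin n → MvPolynomial (Fin n) F)
    (fun i => by
      refine MvPolynomial.IsHomogeneous.sum _ _ _ fun j _ => ?_
      rw [MvPolynomial.smul_eq_C_mul]
      exact (isHomogeneous_X F j).C_mul _)
  rwa [one_mul] at this

lemma mem_invRing (ρ : Representation F G (Fin n → F)) (f : MvPolynomial (Fin n) F) :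
    f ∈ invRing ρ ↔ ∀ g, polyAct ρ g f = f := by
  simp [invRing, Algebra.mem_iInf, AlgHom.mem_equalizer]

/-- The averaging operator, without the normalizing factor. -/
noncomputable def tra [Fintype G] (ρ : Representation F G (Fin n → F)) :
    MvPolynomial (Fin n) F →ₗ[F] MvPolynomial (Fin n) F := ∑ g : G, (polyAct ρ g).toLinearMap

lemma tra_apply [Fintype G] (ρ : Representation F G (Fin n → F)) (f : MvPolynomial (Fin n) F) :
    tra ρ f = ∑ g : G, polyAct ρ g f := by
  simp [tra]

lemma tra_mem [Fintype G] (ρ : Representation F G (Fin n → F)) (f : MvPolynomial (Fin n) F) :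
    tra ρ f ∈ invRing ρ := by
  rw [mem_invRing]
  intro h
  rw [tra_apply, map_sum]
  refine Fintype.sum_equiv (Equiv.mulRight h) _ _ fun g => ?_
  rw [← polyAct_mul]; rfl

lemma tra_mul [Fintype G] (ρ : Representation F G (Fin n → F)) {t : MvPolynomial (Fin n) F}
    (ht : t ∈ invRing ρ) (f : MvPolynomial (Fin n) F) : tra ρ (t * f) = t * tra ρ f := by
  rw [mem_invRing] at ht
  simp only [tra_apply, map_mul, ht, Finset.mul_sum]

lemma tra_of_mem [Fintype G] (ρ : Representation F G (Fin n → F)) {t : MvPolynomial (Fin n) F}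
    (ht : t ∈ invRing ρ) : tra ρ t = (Nat.card G : F) • t := by
  rw [mem_invRing] at ht
  simp [tra_apply, ht, MvPolynomial.smul_eq_C_mul]

/-- Images of homogeneous polynomials of degree `i`. -/
def homImg {G K : Type*} [Field K] [Algebra F K] (c : MvPolynomial (Fin n) F →ₐ[F] (G → K))
    (i : ℕ) : Set (G → K) :=
  {u | ∃ f : MvPolynomial (Fin n) F, f.IsHomogeneous i ∧ c f = u}

lemma homImg_pow {K : Type*} [Field K] [Algebra F K] (c : MvPolynomial (Fin n) F →ₐ[F] (G → K))
    (k : ℕ) : (Submodule.span K (homImg c 1)) ^ k ≤ Submodule.span K (homImg c k) := by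
  induction k with
  | zero =>
    rw [pow_zero, Submodule.one_eq_span, Submodule.span_le, Set.singleton_subset_iff]
    exact Submodule.subset_span ⟨1, isHomogeneous_one _ _, map_one c⟩
  | succ k ih =>
    rw [pow_succ, Submodule.mul_le]
    intro a ha b hb
    have hab : a * b ∈ Submodule.span K (homImg c k) * Submodule.span K (homImg c 1) :=
      Submodule.mul_mem_mul (ih ha) hb
    rw [Submodule.span_mul_span] at hab
    refine Submodule.span_mono ?_ hab
    rintro _ ⟨_, ⟨f, hf, rfl⟩, _, ⟨f', hf', rfl⟩, rfl⟩
    exact ⟨f * f', hf.mul hf', map_mul c f f'⟩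

lemma homImg_tstable {K : Type*} [Field K] [Algebra F K]
    (c : MvPolynomial (Fin n) F →ₐ[F] (G → K)) (ρ : Representation F G (Fin n → F))
    (hctr : ∀ (h : G) f, pbk K (fun x => x * h) (c f) = c (polyAct ρ h⁻¹ f)) :
    TStable (Submodule.span K (homImg c 1)) := by
  intro h f hf
  induction hf using Submodule.span_induction with
  | mem x hx =>
    obtain ⟨f, hf, rfl⟩ := hx
    exact Submodule.subset_span ⟨_, polyAct_isHomogeneous ρ h⁻¹ hf, (hctr h f).symm⟩
  | zero => rw [map_zero]; exact Submodule.zero_mem _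
  | add x y _ _ hx hy => rw [map_add]; exact Submodule.add_mem _ hx hy
  | smul a x _ hx => rw [map_smul]; exact Submodule.smul_mem _ a hx

lemma exists_pi_algHom {K : Type*} [Field K] [Algebra F K]
    (ρ : Representation F G (Fin n → F)) (v : Fin n → K) :
    ∃ c : MvPolynomial (Fin n) F →ₐ[F] (G → K), ∀ f g, c f g = aeval v (polyAct ρ g⁻¹ f) :=
  ⟨AlgHom.pi (fun g => (aeval v).comp (polyAct ρ g⁻¹)), fun _ _ => rfl⟩

lemma tra_mem_subComp [Fintype G] (ρ : Representation F G (Fin n → F))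
    {f : MvPolynomial (Fin n) F} {i : ℕ} (hf : f.IsHomogeneous i) :
    tra ρ f ∈ subComp (invRing ρ) i := by
  refine ⟨tra_mem ρ f, ?_⟩
  rw [SetLike.mem_coe, mem_homogeneousSubmodule, tra_apply]
  exact MvPolynomial.IsHomogeneous.sum _ _ _ fun g _ => polyAct_isHomogeneous ρ g hf

lemma exists_invariant_ne_zero [Finite G] {K : Type*} [Field K] [Algebra F K]
    (hG : (Nat.card G : F) ≠ 0) {d : ℕ} (hd : SigBound K G d)
    (ρ : Representation F G (Fin n → F)) (v : Fin n → K) (hv : v ≠ 0) :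
    ∃ i, 1 ≤ i ∧ i ≤ d ∧ ∃ f ∈ subComp (invRing ρ) i, aeval v f ≠ 0 := by
  classical
  have : Fintype G := Fintype.ofFinite G
  obtain ⟨c, hc⟩ := exists_pi_algHom (K := K) ρ v
  have hctr : ∀ (h : G) f, pbk K (fun x => x * h) (c f) = c (polyAct ρ h⁻¹ f) := by
    intro h f
    ext x
    rw [pbk_apply, hc, hc, mul_inv_rev, polyAct_mul]
  have hW0 : Submodule.span K (homImg c 1) ≠ ⊥ := by
    obtain ⟨a, ha⟩ := Function.ne_iff.1 hv
    rw [Submodule.ne_bot_iff]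
    refine ⟨c (X a), Submodule.subset_span ⟨_, isHomogeneous_X F a, rfl⟩, ?_⟩
    intro h
    have := congrFun h 1
    rw [hc, inv_one, polyAct_one, aeval_X] at this
    exact ha this
  obtain ⟨i, h1, h2, h3⟩ := hd _ (homImg_tstable c ρ hctr) hW0
  have h4 := homImg_pow c i h3
  by_contra! hcon
  have hz : ∀ u ∈ Submodule.span K (homImg c i), ∑ g : G, u g = 0 := by
    intro u hu
    induction hu using Submodule.span_induction with
    | mem x hx =>
      obtain ⟨f, hf, rfl⟩ := hx
      have h5 := hcon i h1 h2 (tra ρ f) (tra_mem_subComp ρ hf)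
      rw [tra_apply, map_sum] at h5
      rw [← h5]
      simp only [hc]
      exact Equiv.sum_comp (Equiv.inv G) (fun g => aeval v (polyAct ρ g f))
    | zero => simp
    | add x y _ _ hx hy => simp only [Pi.add_apply, Finset.sum_add_distrib, hx, hy, add_zero]
    | smul a x _ hx => simp only [Pi.smul_apply, ← Finset.smul_sum, hx, smul_zero]
  have h6 := hz 1 h4
  simp only [Pi.one_apply, Finset.sum_const, Finset.card_univ, nsmul_eq_mul, mul_one] at h6
  rw [← Nat.card_eq_fintype_card, ← map_natCast (algebraMap F K)] at h6
  exact hG ((map_eq_zero _).1 h6)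

lemma fgOver_of_points [Finite G] {K : Type*} [Field K] [IsAlgClosed K] [Algebra F K]
    (hG : (Nat.card G : F) ≠ 0) {d : ℕ} (hd : SigBound K G d)
    (ρ : Representation F G (Fin n → F)) :
    fgOver (invRing ρ) (Algebra.adjoin F
      (⋃ i ∈ Set.Iic d, (subComp (invRing ρ) i : Set (MvPolynomial (Fin n) F)))) := by
  classical
  have : Fintype G := Fintype.ofFinite G
  set T := Algebra.adjoin F
      (⋃ i ∈ Set.Iic d, (subComp (invRing ρ) i : Set (MvPolynomial (Fin n) F))) with hT
  have hTS : T ≤ invRing ρ := by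
    rw [hT, Algebra.adjoin_le_iff]
    intro x hx
    simp only [Set.mem_iUnion] at hx
    obtain ⟨i, _, hx⟩ := hx
    exact hx.1
  let gens : Set (MvPolynomial (Fin n) F) := {f | ∃ i, 1 ≤ i ∧ i ≤ d ∧ f ∈ subComp (invRing ρ) i}
  let I : Ideal (MvPolynomial (Fin n) F) := Ideal.span gens
  have hX : ∀ a, (X a : MvPolynomial (Fin n) F) ∈ I.radical := by
    intro a
    rw [← vanishingIdeal_zeroLocus_eq_radical (K := K), mem_vanishingIdeal_iff]
    intro v hv
    rw [aeval_X]
    by_contra hva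
    obtain ⟨i, h1, h2, f, hf, hne⟩ := exists_invariant_ne_zero hG hd ρ v
      (fun h => hva (by rw [h]; rfl))
    exact hne (hv f (Ideal.subset_span ⟨i, h1, h2, hf⟩))
  obtain ⟨D, hD⟩ := Ideal.exists_radical_pow_le_of_fg I (IsNoetherian.noetherian _)
  have hmon : ∀ m : Fin n →₀ ℕ, D ≤ m.degree → (monomial m (1 : F)) ∈ I := by
    intro m hm
    apply hD
    refine Ideal.pow_le_pow_right hm ?_
    rw [MvPolynomial.monomial_eq, map_one, one_mul, Finsupp.degree_apply, ← Finset.prod_pow_eq_pow_sum]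
    refine Ideal.prod_mem_prod fun a _ => Ideal.pow_mem_pow (hX a) _
  let B0 : Finset (MvPolynomial (Fin n) F) :=
    ((Finset.range D).biUnion fun e => Finset.univ.finsuppAntidiag e).image
      fun m => monomial m (1 : F)
  let P : Submodule F (MvPolynomial (Fin n) F) :=
    Subalgebra.toSubmodule T * Submodule.span F (B0 : Set (MvPolynomial (Fin n) F))
  have hPT : ∀ t ∈ T, ∀ x ∈ P, t * x ∈ P := by
    intro t ht x hx
    have h1 : t * x ∈ Subalgebra.toSubmodule T * P := Submodule.mul_mem_mul ht hx
    rwa [← mul_assoc, (Subalgebra.isIdempotentElem_toSubmodule T).eq] at h1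
  have hexp : ∀ (f : MvPolynomial (Fin n) F) (Q : Submodule F (MvPolynomial (Fin n) F)),
      (∀ m ∈ f.support, monomial m (1 : F) ∈ Q) → f ∈ Q := by
    intro f Q h
    rw [f.as_sum]
    refine Submodule.sum_mem _ fun m hm => ?_
    have : monomial m (coeff m f) = coeff m f • monomial m (1 : F) := by
      rw [smul_monomial, smul_eq_mul, mul_one]
    rw [this]
    exact Q.smul_mem _ (h m hm)
  have hdeg : ∀ (e : ℕ) (f : MvPolynomial (Fin n) F), f.IsHomogeneous e → ∀ m ∈ f.support,
      m.degree = e := by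
    intro e f hf m hm
    have := hf (mem_support_iff.1 hm)
    rwa [Finsupp.degree_eq_weight_one]
  have hall : ∀ e, ∀ f : MvPolynomial (Fin n) F, f.IsHomogeneous e → f ∈ P := by
    intro e
    induction e using Nat.strong_induction_on with
    | _ e ih =>
    intro f hf
    rcases lt_or_ge e D with he | he
    · refine hexp f P fun m hm => ?_
      have h1 : monomial m (1 : F) ∈ Submodule.span F (B0 : Set (MvPolynomial (Fin n) F)) := by
        refine Submodule.subset_span (Finset.mem_coe.2 (Finset.mem_image.2 ⟨m, ?_, rfl⟩))
        rw [Finset.mem_biUnion]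
        refine ⟨e, Finset.mem_range.2 he, ?_⟩
        rw [Finset.mem_finsuppAntidiag]
        refine ⟨?_, Finset.subset_univ _⟩
        rw [← hdeg e f hf m hm, Finsupp.degree_eq_sum]
      have h2 := Submodule.mul_mem_mul (show (1 : MvPolynomial (Fin n) F) ∈
        Subalgebra.toSubmodule T from T.one_mem) h1
      rwa [one_mul] at h2
    · have hfI : f ∈ I := by
        refine hexp f (I.restrictScalars F) fun m hm => ?_
        exact hmon m (by rw [hdeg e f hf m hm]; exact he)
      have key : ∀ x ∈ I, ∀ h : MvPolynomial (Fin n) F, homogeneousComponent e (h * x) ∈ P := by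
        intro x hx
        induction hx using Submodule.span_induction with
        | mem x hx =>
          obtain ⟨i, h1, h2, hxi⟩ := hx
          intro h
          have hxh : x.IsHomogeneous i := hxi.2
          have hxT : x ∈ T := by
            refine Algebra.subset_adjoin ?_
            simp only [Set.mem_iUnion]
            exact ⟨i, h2, hxi⟩
          rw [← sum_homogeneousComponent h, Finset.sum_mul, map_sum]
          refine Submodule.sum_mem _ fun k _ => ?_
          have hk := (homogeneousComponent_isHomogeneous k h).mul hxh
          rw [homogeneousComponent_of_mem hk]
          split_ifs with hke
          · rw [mul_comm]
            exact hPT x hxT _ (ih k (by omega) _ (homogeneousComponent_isHomogeneous k h))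
          · exact P.zero_mem
        | zero => intro h; simp
        | add x y _ _ hx hy => intro h; rw [mul_add, map_add]; exact P.add_mem (hx h) (hy h)
        | smul a x _ hx => intro h; rw [smul_eq_mul, ← mul_assoc]; exact hx _
      have := key f hfI 1
      rwa [one_mul, homogeneousComponent_of_mem hf, if_pos rfl] at this
  have htop : ∀ f, f ∈ P := by
    intro f
    rw [← sum_homogeneousComponent f]
    exact Submodule.sum_mem _ fun k _ => hall k _ (homogeneousComponent_isHomogeneous k f)
  refine ⟨B0.image (tra ρ), ?_, ?_⟩
  · intro x hx
    obtain ⟨b, _, rfl⟩ := Finset.mem_image.1 (Finset.mem_coe.1 hx)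
    exact tra_mem ρ b
  · intro f hf
    have hmem : ∀ x ∈ P, tra ρ x ∈ Subalgebra.toSubmodule T *
        Submodule.span F ((B0.image (tra ρ) : Finset _) : Set (MvPolynomial (Fin n) F)) := by
      intro x hx
      refine Submodule.mul_induction_on hx ?_ ?_
      · intro t ht b hb
        rw [tra_mul ρ (hTS ht)]
        refine Submodule.mul_mem_mul ht ?_
        rw [Finset.coe_image, ← Submodule.map_span]
        exact Submodule.mem_map_of_mem hb
      · intro x y hx hy
        rw [map_add]
        exact Submodule.add_mem _ hx hy
    have h1 := hmem f (htop f)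
    rw [tra_of_mem ρ hf] at h1
    have h2 := Submodule.smul_mem _ (Nat.card G : F)⁻¹ h1
    rwa [smul_smul, inv_mul_cancel₀ hG, one_smul] at h2

end Bridge


/-- If `G` is a finite non-cyclic group of order invertible in `F` and `q` is the smallest
prime divisor of `|G|`, then `σ(G) ≤ |G|/q`, i.e. `q ⬝ σ(G,V) ≤ |G|` for every `G`-module. -/
theorem sigmaAlg_le_card_div_minFac {F : Type*} [Field F] {G : Type*} [Group G] [Finite G]
    (hG : (Nat.card G : F) ≠ 0) (hnc : ¬ IsCyclic G) :
    ∀ (n : ℕ) (ρ : Representation F G (Fin n → F)),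
      (Nat.card G).minFac * sigmaAlg (invRing ρ) ≤ Nat.card G := by
  intro n ρ
  have hK : (Nat.card G : AlgebraicClosure F) ≠ 0 := by
    rw [← map_natCast (algebraMap F (AlgebraicClosure F))]
    exact fun h => hG ((map_eq_zero _).1 h)
  have hd := SigBound.of_not_isCyclic (K := AlgebraicClosure F) (Nat.card G) (G := G) rfl hK hnc
  have h1 : sigmaAlg (invRing ρ) ≤ Nat.card G / (Nat.card G).minFac :=
    Nat.sInf_le (fgOver_of_points hG hd ρ)
  calc (Nat.card G).minFac * sigmaAlg (invRing ρ)
      ≤ (Nat.card G).minFac * (Nat.card G / (Nat.card G).minFac) := Nat.mul_le_mul_left _ h1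
    _ ≤ Nat.card G := Nat.mul_div_le _ _
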